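/- Let D_n be the n-th period-doubling word. Then Att(D_2) = {{2, 3}, {2, 4}}, and for every n ≥ 3, Att(D_n) = {{3·2^{n-3}, 3·2^{n-2}}, {2^{n-1}, 3·2^{n-2}}} (positions 1-based); i.e., these are exactly the smallest string attractors of D_n. -/

import Mathlib

/-- The period-doubling morphism over {a, b} (with `false` = a, `true` = b):
φ(a) = ab, φ(b) = aa. -/
def phi : Bool → List Bool
  | false => [false, true]
  | true => [false, false]

/-- Period-doubling words: D 0 = a, D (n+1) = φ(D n); |D n| = 2^n. -/
def D : ℕ → List Bool
  | 0 => [false]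
  | n + 1 => (D n).flatMap phi

/-- `w` occurs in `T` at (1-based) position `i`, i.e. `w = T[i .. i + |w| - 1]`. -/
def OccursAt {α : Type*} (T w : List α) (i : ℕ) : Prop :=
  1 ≤ i ∧ i + w.length ≤ T.length + 1 ∧ (T.drop (i - 1)).take w.length = w

/-- `Γ` is a string attractor of `T`: a set of (1-based) positions of `T` such that
every nonempty substring of `T` has an occurrence crossing a position of `Γ`. -/
def IsAttractor {α : Type*} (T : List α) (Γ : Finset ℕ) : Prop :=
  (∀ k ∈ Γ, 1 ≤ k ∧ k ≤ T.length) ∧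
  ∀ w : List α, w ≠ [] → w <:+: T →
    ∃ i, OccursAt T w i ∧ ∃ k ∈ Γ, i ≤ k ∧ k < i + w.length

/-- `Γ` is a smallest string attractor of `T`. -/
def IsSmallestAttractor {α : Type*} (T : List α) (Γ : Finset ℕ) : Prop :=
  IsAttractor T Γ ∧ ∀ Γ' : Finset ℕ, IsAttractor T Γ' → Γ.card ≤ Γ'.card

/-- The set of all smallest string attractors of `T`. -/
def Att {α : Type*} (T : List α) : Set (Finset ℕ) := {Γ | IsSmallestAttractor T Γ}

/-- The `z`-th letter: the parity of the 2-adic valuation. -/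
noncomputable def dd (z : ℤ) : Bool := decide (Odd (padicValInt 2 z))

theorem dd_pow_mul (k : ℕ) (c : ℤ) (hc : Odd c) : dd (2 ^ k * c) = decide (Odd k) := by
  have hc0 : c ≠ 0 := by rintro rfl; simp at hc
  have hv : padicValInt 2 c = 0 := by
    apply padicValInt.eq_zero_of_not_dvd
    intro h
    have := Int.not_even_iff_odd.mpr hc
    exact this (even_iff_two_dvd.mpr (by exact_mod_cast h))
  have hp : padicValInt 2 ((2 : ℤ) ^ k) = k := by
    unfold padicValInt
    rw [Int.natAbs_pow]
    exact padicValNat.prime_pow k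
  unfold dd
  rw [padicValInt.mul (by positivity) hc0, hv, hp]
  simp

theorem dd_odd (c : ℤ) (hc : Odd c) : dd c = false := by
  have := dd_pow_mul 0 c hc
  simpa using this

theorem exists_pow_odd (s : ℤ) (hs : s ≠ 0) : ∃ (k : ℕ) (c : ℤ), Odd c ∧ s = 2 ^ k * c := by
  obtain ⟨c, h, hc⟩ := (Int.finiteMultiplicity_iff.mpr
    (⟨by norm_num, hs⟩ : (2 : ℤ).natAbs ≠ 1 ∧ s ≠ 0)).exists_eq_pow_mul_and_not_dvd
  exact ⟨_, c, by rw [← Int.not_even_iff_odd, even_iff_two_dvd]; exact hc, h⟩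

theorem dd_two_mul (z : ℤ) (hz : z ≠ 0) : dd (2 * z) = !dd z := by
  obtain ⟨k, c, hc, rfl⟩ := exists_pow_odd z hz
  rw [← mul_assoc, ← pow_succ', dd_pow_mul _ _ hc, dd_pow_mul _ _ hc]
  by_cases h : Odd k <;> simp [h, Nat.odd_add_one]

/-- the letters with zero-based indices -/
noncomputable def ff (t : ℕ) : Bool := dd ((t : ℤ) + 1)

theorem flat_range (N : ℕ) :
    ((List.range N).map ff).flatMap phi = (List.range (2 * N)).map ff := by
  induction N with
  | zero => simp
  | succ N ih =>
    have h2 : 2 * (N + 1) = 2 * N + 1 + 1 := by ring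
    rw [h2, List.range_succ, List.range_succ, List.range_succ]
    simp only [List.map_append, List.flatMap_append, ih, List.append_assoc]
    congr 1
    have e1 : ff (2 * N) = false := by
      unfold ff
      apply dd_odd
      exact ⟨N, by push_cast; ring⟩
    have e2 : ff (2 * N + 1) = !ff N := by
      unfold ff
      rw [← dd_two_mul _ (by positivity)]
      congr 1
    simp only [List.map_cons, List.map_nil, List.flatMap_cons, List.flatMap_nil, e1, e2]
    cases ff N <;> simp [phi]

theorem D_eq (n : ℕ) : D n = (List.range (2 ^ n)).map ff := by
  induction n with
  | zero =>
    have : ff 0 = false := dd_odd _ ⟨0, by norm_num⟩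
    simp [D, this]
  | succ n ih => rw [D, ih, flat_range, pow_succ']

theorem occ_iff (M : ℕ) (w : List Bool) (i : ℕ) :
    OccursAt ((List.range M).map ff) w i ↔ 1 ≤ i ∧ i + w.length ≤ M + 1 ∧
      ∀ t (h : t < w.length), w[t] = ff (i - 1 + t) := by
  unfold OccursAt
  simp only [List.length_map, List.length_range]
  constructor
  · rintro ⟨h1, h2, h3⟩
    refine ⟨h1, h2, fun t h => ?_⟩
    have h4 : w[t]? = (((List.range M).map ff).drop (i - 1) |>.take w.length)[t]? := by rw [h3]
    rw [List.getElem?_take_of_lt h, List.getElem?_drop, List.getElem?_map,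
      List.getElem?_range (by omega), List.getElem?_eq_getElem h] at h4
    simpa using h4
  · rintro ⟨h1, h2, h3⟩
    refine ⟨h1, h2, ?_⟩
    apply List.ext_getElem
    · simp; omega
    · intro t ha hb
      rw [h3 t hb]
      simp

/-- matching of an interval with its shift -/
def Mt (i j s : ℤ) : Prop := ∀ m, i ≤ m → m ≤ j → dd m = dd (m + s)

theorem attr_iff (n : ℕ) (Γ : Finset ℕ) : IsAttractor (D n) Γ ↔
    (∀ k ∈ Γ, 1 ≤ k ∧ k ≤ 2 ^ n) ∧ ∀ i j : ℤ, 1 ≤ i → i ≤ j → j ≤ 2 ^ n →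
      ∃ s, 1 ≤ i + s ∧ j + s ≤ 2 ^ n ∧ Mt i j s ∧ ∃ k ∈ Γ, i + s ≤ (k : ℤ) ∧ (k : ℤ) ≤ j + s := by
  rw [D_eq]
  generalize hM : 2 ^ n = M
  have hM' : (2 : ℤ) ^ n = (M : ℤ) := by rw [← hM]; push_cast; rfl
  rw [hM']
  unfold IsAttractor
  simp only [List.length_map, List.length_range, occ_iff]
  refine and_congr_right fun _ => ?_
  constructor
  · intro H i j hi hij hj
    obtain ⟨a, rfl⟩ : ∃ a : ℕ, i = a + 1 := ⟨(i - 1).toNat, by omega⟩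
    obtain ⟨l, rfl⟩ : ∃ l : ℕ, j = a + 1 + l := ⟨(j - (a + 1)).toNat, by omega⟩
    have hlen : ((((List.range M).map ff).drop a).take (l + 1)).length = l + 1 := by
      simp; omega
    obtain ⟨i', ⟨h1, h2, h3⟩, k, hk, hk1, hk2⟩ := H ((((List.range M).map ff).drop a).take (l + 1))
      (by intro h; rw [h] at hlen; simp at hlen)
      ((List.take_prefix _ _).isInfix.trans (List.drop_suffix _ _).isInfix)
    rw [hlen] at h2 hk2
    refine ⟨(i' : ℤ) - (a + 1), by omega, by omega, ?_, k, hk, by omega, by omega⟩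
    intro m hm1 hm2
    obtain ⟨t, rfl⟩ : ∃ t : ℕ, m = a + 1 + t := ⟨(m - (a + 1)).toNat, by omega⟩
    have := h3 t (by rw [hlen]; omega)
    simp only [List.getElem_take, List.getElem_drop, List.getElem_map, List.getElem_range, ff] at this
    rw [show (a : ℤ) + 1 + t = ((a + t : ℕ) : ℤ) + 1 by push_cast; ring, this]
    congr 1
    omega
  · intro H w hw hin
    obtain ⟨u, v, huv⟩ := hin
    have hL : u.length + w.length + v.length = M := by
      have := congrArg List.length huv
      simp at this
      omega
    have hwl : 0 < w.length := List.length_pos_iff.mpr hw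
    have hget : ∀ t (h : t < w.length), w[t] = ff (u.length + t) := by
      intro t h
      have h4 : (u ++ w ++ v)[u.length + t]? = ((List.range M).map ff)[u.length + t]? := by rw [huv]
      rw [List.append_assoc, List.getElem?_append_right (by omega), Nat.add_sub_cancel_left,
        List.getElem?_append_left h, List.getElem?_map,
        List.getElem?_range (by omega), List.getElem?_eq_getElem h] at h4
      simpa using h4
    obtain ⟨s, h1, h2, h3, k, hk, hk1, hk2⟩ := H (u.length + 1) (u.length + w.length)
      (by omega) (by omega) (by omega)
    refine ⟨(u.length + 1 + s).toNat, ⟨by omega, by omega, fun t h => ?_⟩, k, hk, by omega, by omega⟩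
    rw [hget t h]
    have := h3 (u.length + 1 + t) (by omega) (by omega)
    unfold ff
    rw [show ((u.length + t : ℕ) : ℤ) + 1 = u.length + 1 + t by push_cast; ring, this]
    congr 1
    omega

theorem mis1 (k : ℕ) (c e : ℤ) (hc : Odd c) (he : Odd e) :
    dd (2 ^ (k + 1) * e) ≠ dd (2 ^ (k + 1) * e + 2 ^ k * c) := by
  rw [show (2 : ℤ) ^ (k + 1) * e + 2 ^ k * c = 2 ^ k * (2 * e + c) by ring, dd_pow_mul _ _ he,
    dd_pow_mul _ _ ((even_two_mul e).add_odd hc)]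
  by_cases h : Odd k <;> simp [h, Nat.odd_add_one]

theorem mis_long (i j : ℤ) (k : ℕ) (c : ℤ) (hc : Odd c) (hl : 3 * 2 ^ k ≤ j - i + 1)
    (h : Mt i j (2 ^ k * c)) : False := by
  have hK : (0 : ℤ) < 2 ^ k := by positivity
  -- the first multiple of 2^k at or after i
  obtain ⟨a, ha1, ha2⟩ : ∃ a : ℤ, i ≤ 2 ^ k * a ∧ 2 ^ k * a ≤ i + 2 ^ k - 1 := by
    refine ⟨(i + 2 ^ k - 1) / 2 ^ k, ?_, ?_⟩
    · have := Int.emod_add_mul_ediv (i + 2 ^ k - 1) (2 ^ k)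
      have := Int.emod_lt_of_pos (i + 2 ^ k - 1) hK
      linarith
    · have := Int.emod_add_mul_ediv (i + 2 ^ k - 1) (2 ^ k)
      have := Int.emod_nonneg (i + 2 ^ k - 1) hK.ne'
      linarith
  have key : ∃ t : ℤ, 0 ≤ t ∧ t ≤ 2 ∧ ((a + t) % 4 = 2 ∨ (a + t + c) % 4 = 2) := by
    have hc2 : c % 2 = 1 := Int.odd_iff.mp hc
    by_cases h1 : a % 4 = 3
    · by_cases h2 : (a + c) % 4 = 2
      · exact ⟨0, by omega, by omega, by omega⟩
      · exact ⟨2, by omega, by omega, by omega⟩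
    · by_cases h2 : a % 4 = 2
      · exact ⟨0, by omega, by omega, by omega⟩
      · by_cases h3 : a % 4 = 1
        · exact ⟨1, by omega, by omega, by omega⟩
        · exact ⟨2, by omega, by omega, by omega⟩
  obtain ⟨t, ht0, ht2, ht⟩ := key
  have hm := h (2 ^ k * (a + t)) (by nlinarith) (by nlinarith)
  rcases ht with ht | ht
  · obtain ⟨e, he⟩ : ∃ e, a + t = 2 * e := ⟨(a + t) / 2, by omega⟩
    have heo : Odd e := Int.odd_iff.mpr (by omega)
    apply mis1 k c e hc heo
    rw [he] at hm
    rw [pow_succ, mul_assoc]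
    exact hm
  · obtain ⟨e, he⟩ : ∃ e, a + t + c = 2 * e := ⟨(a + t + c) / 2, by omega⟩
    have heo : Odd e := Int.odd_iff.mpr (by omega)
    apply mis1 k (-c) e hc.neg heo
    have e1 : a + t = 2 * e - c := by omega
    rw [e1] at hm
    rw [show (2 : ℤ) ^ (k + 1) * e + 2 ^ k * (-c) = 2 ^ k * (2 * e - c) by ring, hm]
    congr 1
    ring

theorem syncA (p : ℕ) (i j s : ℤ) (hl : 3 * 2 ^ p ≤ 2 * (j - i + 1) + 1) (h : Mt i j s) :
    ∃ c, s = 2 ^ p * c := by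
  by_cases hs : s = 0
  · exact ⟨0, by simp [hs]⟩
  obtain ⟨k, c, hc, rfl⟩ := exists_pow_odd s hs
  by_cases hk : p ≤ k
  · exact ⟨2 ^ (k - p) * c, by rw [← mul_assoc, ← pow_add]; congr 2; omega⟩
  · exfalso
    have : (2 : ℤ) ^ (k + 1) ≤ 2 ^ p := pow_le_pow_right₀ (by norm_num) (by omega)
    rw [pow_succ] at this
    exact mis_long i j k c hc (by omega) h

theorem syncB (p : ℕ) (i j s e : ℤ) (hl : 2 ^ p - 1 ≤ j - i + 1) (he : Odd e)
    (h1 : i ≤ 2 ^ p * e) (h2 : 2 ^ p * e ≤ j) (h : Mt i j s) :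
    ∃ c, s = 2 ^ p * c := by
  by_cases hs : s = 0
  · exact ⟨0, by simp [hs]⟩
  obtain ⟨k, c, hc, rfl⟩ := exists_pow_odd s hs
  by_cases hk : p ≤ k
  · exact ⟨2 ^ (k - p) * c, by rw [← mul_assoc, ← pow_add]; congr 2; omega⟩
  · exfalso
    by_cases hk1 : p = k + 1
    · subst hk1
      exact mis1 k c e hc he (h _ h1 h2)
    · have : (2 : ℤ) ^ (k + 2) ≤ 2 ^ p := pow_le_pow_right₀ (by norm_num) (by omega)
      rw [pow_add] at this
      have h0 : (1 : ℤ) ≤ 2 ^ k := one_le_pow₀ (by norm_num)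
      exact mis_long i j k c hc (by linarith) h

/-- the letters at multiples of `q = 2^p` -/
theorem vals (p : ℕ) : ∃ P : Bool, dd (2 ^ p) = P ∧ dd (2 ^ p * 2) = !P ∧ dd (2 ^ p * 3) = P ∧
    dd (2 ^ p * 4) = P ∧ dd (2 ^ p * 5) = P ∧ dd (2 ^ p * 6) = !P ∧ dd (2 ^ p * 7) = P ∧
    dd (2 ^ p * 8) = !P := by
  refine ⟨decide (Odd p), ?_, ?_, ?_, ?_, ?_, ?_, ?_, ?_⟩
  · simpa using dd_pow_mul p 1 (by decide)
  · have := dd_pow_mul (p + 1) 1 (by decide)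
    rw [show (2 : ℤ) ^ p * 2 = 2 ^ (p + 1) * 1 by ring, this]
    by_cases h : Odd p <;> simp [h, Nat.odd_add_one]
  · exact dd_pow_mul p 3 (by decide)
  · have := dd_pow_mul (p + 2) 1 (by decide)
    rw [show (2 : ℤ) ^ p * 4 = 2 ^ (p + 2) * 1 by ring, this]
    simp [Nat.odd_add]
  · exact dd_pow_mul p 5 (by decide)
  · have := dd_pow_mul (p + 1) 3 (by decide)
    rw [show (2 : ℤ) ^ p * 6 = 2 ^ (p + 1) * 3 by ring, this]
    by_cases h : Odd p <;> simp [h, Nat.odd_add_one]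
  · exact dd_pow_mul p 7 (by decide)
  · have := dd_pow_mul (p + 3) 1 (by decide)
    rw [show (2 : ℤ) ^ p * 8 = 2 ^ (p + 3) * 1 by ring, this]
    by_cases h : Odd p <;> (simp [h, Nat.odd_iff] <;> rw [Nat.odd_iff] at h <;> omega)

/-- shift around a maximal point -/
theorem dd_shift (k : ℕ) (a b t : ℤ) (h1 : -2 ^ k < t) (h2 : t < 2 ^ k) (ht : t ≠ 0) :
    dd (2 ^ k * a + t) = dd (2 ^ k * b + t) := by
  obtain ⟨l, c, hc, rfl⟩ := exists_pow_odd t ht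
  have hlk : l < k := by
    by_contra hcon
    have hle : (2 : ℤ) ^ k ≤ 2 ^ l := pow_le_pow_right₀ (by norm_num) (by omega)
    have h0 : (0 : ℤ) < 2 ^ k := by positivity
    rcases lt_or_ge c 1 with h | h
    · have : c ≤ -1 := by
        rcases eq_or_ne c 0 with rfl | hne
        · simp at hc
        · omega
      nlinarith
    · nlinarith
  obtain ⟨r, rfl⟩ : ∃ r, k = l + 1 + r := ⟨k - (l + 1), by omega⟩
  have aux : ∀ z : ℤ, dd (2 ^ (l + 1 + r) * z + 2 ^ l * c) = decide (Odd l) := by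
    intro z
    rw [show (2 : ℤ) ^ (l + 1 + r) * z + 2 ^ l * c = 2 ^ l * (2 * (2 ^ r * z) + c) by ring]
    exact dd_pow_mul _ _ ((even_two_mul _).add_odd hc)
  rw [aux, aux]

theorem exists_center (N : ℕ) (i j : ℤ) (hi : 1 ≤ i) (hij : i ≤ j) (hj : j ≤ 2 ^ N) :
    ∃ (k : ℕ) (c : ℤ), k ≤ N ∧ Odd c ∧ i ≤ 2 ^ k * c ∧ 2 ^ k * c ≤ j ∧ 2 ^ k * c - 2 ^ k < i ∧
      j < 2 ^ k * c + 2 ^ k := by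
  classical
  let P : ℕ → Prop := fun k => ∃ c : ℤ, i ≤ 2 ^ k * c ∧ 2 ^ k * c ≤ j
  have hP0 : P 0 := ⟨i, by simp, by simpa using hij⟩
  have hg : P (Nat.findGreatest P N) := Nat.findGreatest_spec (Nat.zero_le N) hP0
  have hmax : ¬ P (Nat.findGreatest P N + 1) := by
    intro h
    by_cases hN : Nat.findGreatest P N + 1 ≤ N
    · have := Nat.le_findGreatest hN h
      omega
    · obtain ⟨c, h1, h2⟩ := h
      have hlt : (2 : ℤ) ^ N < 2 ^ (Nat.findGreatest P N + 1) :=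
        pow_lt_pow_right₀ (by norm_num) (by omega)
      have hc : 0 < c := by
        by_contra hcon
        have : (0 : ℤ) < 2 ^ (Nat.findGreatest P N + 1) := by positivity
        nlinarith
      nlinarith
  have hle : Nat.findGreatest P N ≤ N := Nat.findGreatest_le N
  generalize Nat.findGreatest P N = k at hg hmax hle
  obtain ⟨c, h1, h2⟩ := hg
  have hK : (0 : ℤ) < 2 ^ k := by positivity
  have hc : Odd c := by
    rw [← Int.not_even_iff_odd]
    rintro ⟨r, rfl⟩
    exact hmax ⟨r, by rw [pow_succ]; linarith, by rw [pow_succ]; linarith⟩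
  refine ⟨k, c, hle, hc, h1, h2, ?_, ?_⟩
  · obtain ⟨r, rfl⟩ := hc
    by_contra hcon
    exact hmax ⟨r, by rw [pow_succ]; linarith, by rw [pow_succ]; linarith⟩
  · obtain ⟨r, rfl⟩ := hc
    by_contra hcon
    exact hmax ⟨r + 1, by rw [pow_succ]; linarith, by rw [pow_succ]; linarith⟩

theorem Mt_center (k : ℕ) (a b i j : ℤ) (h1 : 2 ^ k * a - 2 ^ k < i) (h2 : j < 2 ^ k * a + 2 ^ k)
    (hd : dd (2 ^ k * a) = dd (2 ^ k * b)) : Mt i j (2 ^ k * b - 2 ^ k * a) := by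
  intro m hm1 hm2
  by_cases hm : m = 2 ^ k * a
  · subst hm
    rw [hd]
    congr 1
    ring
  · have := dd_shift k a b (m - 2 ^ k * a) (by linarith) (by linarith)
      (fun h => hm (by linarith))
    rw [show 2 ^ k * a + (m - 2 ^ k * a) = m by ring] at this
    rw [this]
    congr 1
    ring

theorem Mt_zero (i j : ℤ) : Mt i j 0 := by
  intro m _ _
  simp

theorem attr_upper (p : ℕ) (Γ : Finset ℕ) (hΓ : ∀ k ∈ Γ, 1 ≤ k ∧ k ≤ 2 ^ (p + 3))
    (h6 : 2 ^ p * 6 ∈ Γ) (h34 : 2 ^ p * 3 ∈ Γ ∨ 2 ^ p * 4 ∈ Γ) : IsAttractor (D (p + 3)) Γ := by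
  rw [attr_iff]
  refine ⟨hΓ, fun i j hi hij hj => ?_⟩
  have hQ : (0 : ℤ) < 2 ^ p := by positivity
  have e1 : (2 : ℤ) ^ (p + 1) = 2 ^ p * 2 := by ring
  have e2 : (2 : ℤ) ^ (p + 2) = 2 ^ p * 4 := by ring
  have e3 : (2 : ℤ) ^ (p + 3) = 2 ^ p * 8 := by ring
  have c6 : ((2 ^ p * 6 : ℕ) : ℤ) = 2 ^ p * 6 := by push_cast; rfl
  have c4 : ((2 ^ p * 4 : ℕ) : ℤ) = 2 ^ p * 4 := by push_cast; rfl
  have c3 : ((2 ^ p * 3 : ℕ) : ℤ) = 2 ^ p * 3 := by push_cast; rfl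
  obtain ⟨P, v1, v2, v3, v4, v5, v6, v7, v8⟩ := vals p
  obtain ⟨k, c, hk, hc, m1, m2, m3, m4⟩ := exists_center (p + 3) i j hi hij hj
  rw [e3] at hj ⊢
  have hKp : (0 : ℤ) < 2 ^ k := by positivity
  have hcpos : 1 ≤ c := by
    by_contra hcon
    have : c ≤ 0 := by omega
    nlinarith
  rcases Nat.lt_or_ge p k with hkp | hkp
  · obtain rfl | rfl | rfl : k = p + 1 ∨ k = p + 2 ∨ k = p + 3 := by omega
    · -- valuation p + 1
      have hd : dd (2 ^ (p + 1) * c) = dd (2 ^ (p + 1) * 3) := by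
        rw [dd_pow_mul _ _ hc, dd_pow_mul _ _ (by decide)]
      have hM := Mt_center (p + 1) c 3 i j m3 m4 hd
      rw [e1] at *
      refine ⟨_, ?_, ?_, hM, _, h6, ?_, ?_⟩ <;> (try rw [c6]) <;> linarith
    · -- valuation p + 2
      have hc1 : c = 1 := by
        have : c < 3 := by
          by_contra hcon
          have : 3 ≤ c := by omega
          rw [e2] at *
          nlinarith
        have := Int.odd_iff.mp hc
        omega
      subst hc1
      rw [e2] at *
      by_cases hi3 : j < 2 ^ p * 6
      · rcases h34 with h3 | h4
        · by_cases hi4 : i ≤ 2 ^ p * 3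
          · refine ⟨0, ?_, ?_, Mt_zero i j, _, h3, ?_, ?_⟩ <;> (try rw [c3]) <;> linarith
          · refine ⟨-2 ^ p, ?_, ?_, ?_, _, h3, ?_, ?_⟩ <;> (try rw [c3]) <;> try linarith
            intro m hm1 hm2
            by_cases x4 : m = 2 ^ p * 4
            · rw [x4, v4, show (2 : ℤ) ^ p * 4 + -2 ^ p = 2 ^ p * 3 by ring, v3]
            by_cases x5 : m = 2 ^ p * 5
            · rw [x5, v5, show (2 : ℤ) ^ p * 5 + -2 ^ p = 2 ^ p * 4 by ring, v4]
            rcases lt_or_ge m (2 ^ p * 5) with hlt | hge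
            · have := dd_shift p 4 3 (m - 2 ^ p * 4) (by linarith) (by linarith)
                (fun h => x4 (by linarith))
              rw [show 2 ^ p * 4 + (m - 2 ^ p * 4) = m by ring] at this
              rw [this]
              congr 1
              ring
            · have := dd_shift p 5 4 (m - 2 ^ p * 5) (by linarith) (by linarith)
                (fun h => x5 (by linarith))
              rw [show 2 ^ p * 5 + (m - 2 ^ p * 5) = m by ring] at this
              rw [this]
              congr 1
              ring
        · refine ⟨0, ?_, ?_, Mt_zero i j, _, h4, ?_, ?_⟩ <;> (try rw [c4]) <;> linarith
      · refine ⟨0, ?_, ?_, Mt_zero i j, _, h6, ?_, ?_⟩ <;> (try rw [c6]) <;> linarith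
    · -- valuation p + 3
      have hc1 : c = 1 := by
        have : c < 2 := by
          by_contra hcon
          have : 2 ≤ c := by omega
          rw [e3] at *
          nlinarith
        omega
      subst hc1
      rw [e3] at *
      by_cases hi6 : i ≤ 2 ^ p * 6
      · refine ⟨0, ?_, ?_, Mt_zero i j, _, h6, ?_, ?_⟩ <;> (try rw [c6]) <;> linarith
      · have hM := Mt_center (p + 1) 4 3 i j (by rw [e1]; linarith) (by rw [e1]; linarith)
          (by rw [e1, show (2 : ℤ) ^ p * 2 * 4 = 2 ^ p * 8 by ring,
            show (2 : ℤ) ^ p * 2 * 3 = 2 ^ p * 6 by ring, v8, v6])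
        rw [e1] at hM
        refine ⟨_, ?_, ?_, hM, _, h6, ?_, ?_⟩ <;> (try rw [c6]) <;> linarith
  · -- small valuation
    have hKle : (2 : ℤ) ^ k ≤ 2 ^ p := pow_le_pow_right₀ (by norm_num) hkp
    have hg : ∃ (g : ℕ) (e : ℤ), g ∈ Γ ∧ (g : ℤ) = 2 ^ p * e ∧ 3 ≤ e ∧ e ≤ 6 ∧
        dd (2 ^ k * c) = dd (2 ^ p * e) := by
      by_cases hb : dd (2 ^ k * c) = P
      · rcases h34 with h | h
        · exact ⟨_, 3, h, c3, by norm_num, by norm_num, by rw [hb, v3]⟩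
        · exact ⟨_, 4, h, c4, by norm_num, by norm_num, by rw [hb, v4]⟩
      · refine ⟨_, 6, h6, c6, by norm_num, by norm_num, ?_⟩
        rw [v6]
        revert hb
        cases dd (2 ^ k * c) <;> cases P <;> simp
    obtain ⟨g, e, hgΓ, hge, he3, he6, hde⟩ := hg
    have hsplit : (2 : ℤ) ^ p * e = 2 ^ k * (2 ^ (p - k) * e) := by
      rw [← mul_assoc, ← pow_add]
      congr 2
      omega
    have hM := Mt_center k c (2 ^ (p - k) * e) i j m3 m4 (by rw [hde, hsplit])
    rw [← hsplit] at hM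
    refine ⟨_, ?_, ?_, hM, g, hgΓ, ?_, ?_⟩ <;> (try rw [hge]) <;> nlinarith

section lower

variable (p : ℕ) (Γ : Finset ℕ)

/-- the interval form of the attractor condition -/
def Good : Prop := ∀ i j : ℤ, 1 ≤ i → i ≤ j → j ≤ 2 ^ (p + 3) →
  ∃ s, 1 ≤ i + s ∧ j + s ≤ 2 ^ (p + 3) ∧ Mt i j s ∧ ∃ k ∈ Γ, i + s ≤ (k : ℤ) ∧ (k : ℤ) ≤ j + s

theorem getc (H : Good p Γ) (a b e : ℤ) (ha : 1 ≤ a) (hb : b ≤ 8) (hab : a < b) (he : Odd e)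
    (hae : a ≤ e) (heb : e ≤ b) :
    ∃ c : ℤ, 1 ≤ a + c ∧ b + c ≤ 8 ∧
      (∀ x, a ≤ x → x ≤ b → dd (2 ^ p * x) = dd (2 ^ p * (x + c))) ∧
      ∃ k ∈ Γ, 2 ^ p * (a + c) ≤ (k : ℤ) ∧ (k : ℤ) ≤ 2 ^ p * (b + c) := by
  have hQ : (0 : ℤ) < 2 ^ p := by positivity
  have e3 : (2 : ℤ) ^ (p + 3) = 2 ^ p * 8 := by ring
  obtain ⟨s, h1, h2, hM, k, hk, hk1, hk2⟩ := H (2 ^ p * a) (2 ^ p * b) (by nlinarith)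
    (by nlinarith) (by rw [e3]; nlinarith)
  obtain ⟨c, rfl⟩ := syncB p _ _ s e (by nlinarith) he (by nlinarith) (by nlinarith) hM
  rw [← mul_add] at h1 hk1 h2 hk2
  rw [e3] at h2
  refine ⟨c, ?_, le_of_mul_le_mul_left h2 hQ, ?_, k, hk, hk1, hk2⟩
  · exact pos_of_mul_pos_right (by linarith : (0 : ℤ) < 2 ^ p * (a + c)) hQ.le
  · intro x hx1 hx2
    rw [hM _ (mul_le_mul_of_nonneg_left hx1 hQ.le) (mul_le_mul_of_nonneg_left hx2 hQ.le), mul_add]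

theorem uniq (H : Good p Γ) (a e : ℤ) (ha : a = 2 ∨ a = 3 ∨ a = 4 ∨ a = 6) (he : Odd e)
    (hae : a ≤ e) (heb : e ≤ a + 2) :
    ∃ k ∈ Γ, 2 ^ p * a ≤ (k : ℤ) ∧ (k : ℤ) ≤ 2 ^ p * (a + 2) := by
  obtain ⟨c, h1, h2, hm, hk⟩ := getc p Γ H a (a + 2) e (by omega) (by omega) (by omega) he hae heb
  have hc : c = 0 := by
    obtain ⟨P, v1, v2, v3, v4, v5, v6, v7, v8⟩ := vals p
    have x0 := hm a (by omega) (by omega)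
    have x1 := hm (a + 1) (by omega) (by omega)
    have x2 := hm (a + 2) (by omega) (by omega)
    clear hm hk
    have hc1 : -8 ≤ c := by omega
    have hc2 : c ≤ 8 := by omega
    rcases ha with rfl | rfl | rfl | rfl <;> interval_cases c <;> first | omega | simp_all
  subst hc
  simpa using hk

theorem pin (H : Good p Γ) : ∃ x ∈ Γ, ∃ y ∈ Γ, x ≠ y ∧
    (Γ.card = 2 → y = 2 ^ p * 6 ∧ (x = 2 ^ p * 3 ∨ x = 2 ^ p * 4)) := by
  have hQ : (0 : ℤ) < 2 ^ p := by positivity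
  obtain ⟨P, v1, v2, v3, v4, v5, v6, v7, v8⟩ := vals p
  obtain ⟨x, hx, hx1, hx2⟩ := uniq p Γ H 3 3 (by norm_num) (by decide) (by norm_num) (by norm_num)
  obtain ⟨y, hy, hy1, hy2⟩ := uniq p Γ H 6 7 (by norm_num) (by decide) (by norm_num) (by norm_num)
  have hne : x ≠ y := by rintro rfl; linarith
  refine ⟨x, hx, y, hy, hne, fun hcard => ?_⟩
  have hxy : ∀ k ∈ Γ, k = x ∨ k = y := by
    have hsub : ({x, y} : Finset ℕ) ⊆ Γ := by
      intro z hz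
      simp only [Finset.mem_insert, Finset.mem_singleton] at hz
      rcases hz with rfl | rfl <;> assumption
    have := Finset.eq_of_subset_of_card_le hsub (by rw [hcard, Finset.card_pair hne])
    intro k hk
    rw [← this] at hk
    simpa using hk
  -- x ≤ 4q
  have hx4 : (x : ℤ) ≤ 2 ^ p * 4 := by
    obtain ⟨k, hk, hk1, hk2⟩ := uniq p Γ H 2 3 (by norm_num) (by decide) (by norm_num) (by norm_num)
    rcases hxy k hk with rfl | rfl <;> linarith
  have hy6 : (y : ℤ) = 2 ^ p * 6 := by
    by_contra hy6
    have hylt : 2 ^ p * 6 < (y : ℤ) := lt_of_le_of_ne hy1 (Ne.symm hy6)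
    have hxeq : (x : ℤ) = 2 ^ p * 4 := by
      obtain ⟨k, hk, hk1, hk2⟩ := uniq p Γ H 4 5 (by norm_num) (by decide) (by norm_num)
        (by norm_num)
      rcases hxy k hk with rfl | rfl <;> linarith
    have hy7 : (y : ℤ) ≤ 2 ^ p * 7 := by
      obtain ⟨c, h1, h2, hm, k, hk, hk1, hk2⟩ := getc p Γ H 2 3 3 (by norm_num) (by norm_num)
        (by norm_num) (by decide) (by norm_num) (by norm_num)
      have x0 := hm 2 (by norm_num) (by norm_num)
      have x1 := hm 3 (by norm_num) (by norm_num)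
      have hc : c = 0 ∨ c = 4 := by
        clear hm hk1 hk2 hy1 hy2 hx1 hx2 hx4 hxy hxeq hylt hy6
        have hc1 : -1 ≤ c := by omega
        have hc2 : c ≤ 5 := by omega
        interval_cases c <;> first | omega | simp_all
      rcases hc with rfl | rfl <;> rcases hxy k hk with rfl | rfl <;> linarith
    have hy7' : (y : ℤ) < 2 ^ p * 7 := by
      have e3 : (2 : ℤ) ^ (p + 3) = 2 ^ p * 8 := by ring
      obtain ⟨s, h1, h2, hM, k, hk, hk1, hk2⟩ := H (2 ^ p + 1) (2 ^ p * 3 - 1) (by linarith)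
        (by linarith) (by rw [e3]; linarith)
      obtain ⟨c, rfl⟩ := syncA p _ _ s (by linarith) hM
      rw [e3] at h2
      have x0 := hM (2 ^ p * 2) (by linarith) (by linarith)
      rw [← mul_add] at x0
      have hc1 : -1 ≤ c := by
        by_contra hcon
        have : c ≤ -2 := by omega
        nlinarith
      have hc2 : c ≤ 6 := by
        by_contra hcon
        have : 7 ≤ c := by omega
        nlinarith
      have hc : c = 0 ∨ c = 4 ∨ c = 6 := by
        clear hM h1 h2 hk1 hk2 hy1 hy2 hx1 hx2 hx4 hxy hxeq hylt hy6 hy7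
        interval_cases c <;> first | omega | simp_all
      rcases hc with rfl | rfl | rfl <;> rcases hxy k hk with rfl | rfl <;> linarith
    obtain ⟨c, h1, h2, hm, k, hk, hk1, hk2⟩ := getc p Γ H 5 6 5 (by norm_num) (by norm_num)
      (by norm_num) (by decide) (by norm_num) (by norm_num)
    have x0 := hm 5 (by norm_num) (by norm_num)
    have x1 := hm 6 (by norm_num) (by norm_num)
    have hc : c = -4 ∨ c = 0 ∨ c = 2 := by
      clear hm hk1 hk2 hy1 hy2 hx1 hx2 hx4 hxy hxeq hylt hy6 hy7 hy7'
      have hc1 : -4 ≤ c := by omega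
      have hc2 : c ≤ 2 := by omega
      interval_cases c <;> first | omega | simp_all
    rcases hc with rfl | rfl | rfl <;> rcases hxy k hk with rfl | rfl <;> linarith
  refine ⟨by exact_mod_cast hy6, ?_⟩
  by_contra hcon
  push Not at hcon
  have hx3' : 2 ^ p * 3 < (x : ℤ) :=
    lt_of_le_of_ne hx1 (fun h => hcon.1 (by exact_mod_cast h.symm))
  have hx4' : (x : ℤ) < 2 ^ p * 4 :=
    lt_of_le_of_ne hx4 (fun h => hcon.2 (by exact_mod_cast h))
  -- the window of length q - 1 around 3q, cut at x
  have e3 : (2 : ℤ) ^ (p + 3) = 2 ^ p * 8 := by ring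
  obtain ⟨s, h1, h2, hM, k, hk, hk1, hk2⟩ := H ((x : ℤ) + 1 - 2 ^ p) (x - 1) (by linarith)
    (by linarith) (by rw [e3]; linarith)
  obtain ⟨c, rfl⟩ := syncB p _ _ s 3 (by linarith) (by decide) (by linarith) (by linarith) hM
  rw [e3] at h2
  have x0 := hM (2 ^ p * 3) (by linarith) (by linarith)
  rw [← mul_add] at x0
  rcases hxy k hk with rfl | rfl
  · have hc1 : 0 < c := by
      by_contra hcon
      have : c ≤ 0 := by omega
      nlinarith
    have hc2 : c < 1 := by
      by_contra hcon
      have : 1 ≤ c := by omega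
      nlinarith
    omega
  · have hc3 : c = 3 := by
      have hc1 : 2 < c := by
        by_contra hcon
        have : c ≤ 2 := by omega
        nlinarith
      have hc2 : c < 4 := by
        by_contra hcon
        have : 4 ≤ c := by omega
        nlinarith
      omega
    subst hc3
    norm_num at x0
    rw [v3, v6] at x0
    cases P <;> simp at x0

end lower

theorem att_three (p : ℕ) : Att (D (p + 3)) =
    {({2 ^ p * 3, 2 ^ p * 6} : Finset ℕ), ({2 ^ p * 4, 2 ^ p * 6} : Finset ℕ)} := by
  have hq : 0 < 2 ^ p := by positivity
  have e3 : 2 ^ (p + 3) = 2 ^ p * 8 := by ring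
  have low : ∀ Γ, IsAttractor (D (p + 3)) Γ → 2 ≤ Γ.card := by
    intro Γ h
    obtain ⟨x, hx, y, hy, hne, -⟩ := pin p Γ ((attr_iff _ _).mp h).2
    exact Finset.one_lt_card.mpr ⟨x, hx, y, hy, hne⟩
  have a1 : IsAttractor (D (p + 3)) {2 ^ p * 3, 2 ^ p * 6} := by
    apply attr_upper
    · intro k hk
      simp only [Finset.mem_insert, Finset.mem_singleton] at hk
      omega
    · simp
    · simp
  have a2 : IsAttractor (D (p + 3)) {2 ^ p * 4, 2 ^ p * 6} := by
    apply attr_upper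
    · intro k hk
      simp only [Finset.mem_insert, Finset.mem_singleton] at hk
      omega
    · simp
    · simp
  ext Γ
  simp only [Att, Set.mem_setOf_eq, Set.mem_insert_iff, Set.mem_singleton_iff]
  constructor
  · rintro ⟨h, hmin⟩
    have hcard : Γ.card = 2 :=
      le_antisymm ((hmin _ a1).trans Finset.card_le_two) (low Γ h)
    obtain ⟨x, hx, y, hy, hne, hp⟩ := pin p Γ ((attr_iff _ _).mp h).2
    have hΓ : Γ = {x, y} := by
      symm
      apply Finset.eq_of_subset_of_card_le
      · intro z hz
        simp only [Finset.mem_insert, Finset.mem_singleton] at hz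
        rcases hz with rfl | rfl <;> assumption
      · rw [hcard, Finset.card_pair hne]
    obtain ⟨rfl, rfl | rfl⟩ := hp hcard
    · exact Or.inl hΓ
    · exact Or.inr hΓ
  · rintro (rfl | rfl)
    · exact ⟨a1, fun Γ' h => Finset.card_le_two.trans (low Γ' h)⟩
    · exact ⟨a2, fun Γ' h => Finset.card_le_two.trans (low Γ' h)⟩

theorem att_two : Att (D 2) = {({2, 3} : Finset ℕ), ({2, 4} : Finset ℕ)} := by
  have w1 : dd 1 = false := dd_odd 1 (by decide)
  have w3 : dd 3 = false := dd_odd 3 (by decide)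
  have w2 : dd 2 = true := by simpa using dd_pow_mul 1 1 (by decide)
  have w4 : dd 4 = false := by
    have := dd_pow_mul 2 1 (by decide)
    norm_num at this
    exact this.trans (by decide)
  have pin2 : ∀ Γ, IsAttractor (D 2) Γ → 2 ∈ Γ ∧ (3 ∈ Γ ∨ 4 ∈ Γ) := by
    intro Γ h
    obtain ⟨-, H⟩ := (attr_iff _ _).mp h
    constructor
    · obtain ⟨s, h1, h2, hM, k, hk, hk1, hk2⟩ := H 2 2 (by norm_num) (by norm_num) (by norm_num)
      have x0 := hM 2 (by norm_num) (by norm_num)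
      have hs1 : -1 ≤ s := by omega
      have hs2 : s ≤ 2 := by norm_num at h2; omega
      have hs : s = 0 := by
        clear hM hk1 hk2 h1 h2
        interval_cases s <;> simp_all
      subst hs
      have : k = 2 := by omega
      rwa [← this]
    · obtain ⟨s, h1, h2, hM, k, hk, hk1, hk2⟩ := H 3 4 (by norm_num) (by norm_num) (by norm_num)
      have x0 := hM 3 (by norm_num) (by norm_num)
      have x1 := hM 4 (by norm_num) (by norm_num)
      have hs1 : -2 ≤ s := by omega
      have hs2 : s ≤ 0 := by norm_num at h2; omega
      have hs : s = 0 := by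
        clear hM hk1 hk2 h1 h2
        interval_cases s <;> simp_all
      subst hs
      have : k = 3 ∨ k = 4 := by omega
      rcases this with rfl | rfl
      · exact Or.inl hk
      · exact Or.inr hk
  have low : ∀ Γ, IsAttractor (D 2) Γ → 2 ≤ Γ.card := by
    intro Γ h
    obtain ⟨h2, h3 | h4⟩ := pin2 Γ h
    · exact Finset.one_lt_card.mpr ⟨2, h2, 3, h3, by norm_num⟩
    · exact Finset.one_lt_card.mpr ⟨2, h2, 4, h4, by norm_num⟩
  have up : ∀ z : ℕ, z = 3 ∨ z = 4 → IsAttractor (D 2) {2, z} := by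
    intro z hz
    rw [attr_iff]
    refine ⟨?_, fun i j hi hij hj => ?_⟩
    · intro k hk
      simp only [Finset.mem_insert, Finset.mem_singleton] at hk
      omega
    · norm_num at hj ⊢
      by_cases c2 : i ≤ 2 ∧ 2 ≤ j
      · exact ⟨0, by omega, by omega, Mt_zero i j, Or.inl (by omega)⟩
      by_cases cz : i ≤ z ∧ z ≤ j
      · exact ⟨0, by omega, by omega, Mt_zero i j, Or.inr (by omega)⟩
      -- the remaining intervals are single letters a
      have hij' : i = j := by omega
      subst hij'
      have hdi : dd i = false := by
        have : i = 1 ∨ i = 3 ∨ i = 4 := by omega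
        rcases this with rfl | rfl | rfl <;> assumption
      have hdz : dd z = false := by
        rcases hz with rfl | rfl
        · exact w3
        · exact w4
      refine ⟨z - i, by omega, by omega, ?_, Or.inr (by omega)⟩
      intro m hm1 hm2
      have : m = i := by omega
      subst this
      rw [hdi, show m + ((z : ℤ) - m) = z by ring, hdz]
  have a1 := up 3 (Or.inl rfl)
  have a2 := up 4 (Or.inr rfl)
  ext Γ
  simp only [Att, Set.mem_setOf_eq, Set.mem_insert_iff, Set.mem_singleton_iff]
  constructor
  · rintro ⟨h, hmin⟩
    have hle : Γ.card ≤ 2 := (hmin _ a1).trans Finset.card_le_two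
    obtain ⟨h2, h3 | h4⟩ := pin2 Γ h
    · left
      symm
      apply Finset.eq_of_subset_of_card_le
      · intro z hz
        simp only [Finset.mem_insert, Finset.mem_singleton] at hz
        rcases hz with rfl | rfl <;> assumption
      · rw [Finset.card_pair (by norm_num)]
        exact hle
    · right
      symm
      apply Finset.eq_of_subset_of_card_le
      · intro z hz
        simp only [Finset.mem_insert, Finset.mem_singleton] at hz
        rcases hz with rfl | rfl <;> assumption
      · rw [Finset.card_pair (by norm_num)]
        exact hle
  · rintro (rfl | rfl)
    · exact ⟨a1, fun Γ' h => Finset.card_le_two.trans (low Γ' h)⟩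
    · exact ⟨a2, fun Γ' h => Finset.card_le_two.trans (low Γ' h)⟩

/-- Att(D_2) = {{2, 3}, {2, 4}}, and for every n ≥ 3,
Att(D_n) = {{3·2^{n-3}, 3·2^{n-2}}, {2^{n-1}, 3·2^{n-2}}} (positions 1-based). -/
theorem pd_att_characterization :
    Att (D 2) = {({2, 3} : Finset ℕ), ({2, 4} : Finset ℕ)} ∧
    ∀ n : ℕ, 3 ≤ n →
      Att (D n) =
        {({3 * 2 ^ (n - 3), 3 * 2 ^ (n - 2)} : Finset ℕ),
          ({2 ^ (n - 1), 3 * 2 ^ (n - 2)} : Finset ℕ)} := by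
  refine ⟨att_two, fun n hn => ?_⟩
  obtain ⟨p, rfl⟩ : ∃ p, n = p + 3 := ⟨n - 3, by omega⟩
  rw [att_three]
  have e1 : 3 * 2 ^ (p + 3 - 3) = 2 ^ p * 3 := by rw [Nat.add_sub_cancel]; ring
  have e2 : 3 * 2 ^ (p + 3 - 2) = 2 ^ p * 6 := by
    rw [show p + 3 - 2 = p + 1 by omega]; ring
  have e4 : 2 ^ (p + 3 - 1) = 2 ^ p * 4 := by
    rw [show p + 3 - 1 = p + 2 by omega]; ring
  rw [e1, e2, e4]
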